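/- The quotient ring ℤ[x₁,x₂,x₃,y₁,y₂,y₃,z]/I is generated as a module over the subring ℤ[y₁,y₂,y₃] by the images of the twelve monomials x₁^{i₁} x₂^{i₂} z^{j} with 0 ≤ i₁ ≤ 2, 0 ≤ i₂ ≤ 1 and j ∈ {0,1}. -/

import Mathlib

open MvPolynomial

/-- `s₁ = y₁ − y₂` in `ℤ[x₁,x₂,x₃,y₁,y₂,y₃,z]`, where the variables
`x₁,x₂,x₃,y₁,y₂,y₃,z` are `X 0, X 1, X 2, X 3, X 4, X 5, X 6`. -/
noncomputable def s1p : MvPolynomial (Fin 7) ℤ := X 3 - X 4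
/-- `s₂ = y₂ − y₃`. -/
noncomputable def s2p : MvPolynomial (Fin 7) ℤ := X 4 - X 5
/-- `s₃ = y₃ − y₁`. -/
noncomputable def s3p : MvPolynomial (Fin 7) ℤ := X 5 - X 3

/-- The ideal `I` generated by `x₁+x₂+x₃`, `e₂(x) − e₂(s)`, `2z − e₃(x) − e₃(s)`
and `z² − z·e₃(s)`. -/
noncomputable def Ig2 : Ideal (MvPolynomial (Fin 7) ℤ) :=
  Ideal.span {X 0 + X 1 + X 2,
    (X 0 * X 1 + X 0 * X 2 + X 1 * X 2) - (s1p * s2p + s1p * s3p + s2p * s3p),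
    2 * X 6 - X 0 * X 1 * X 2 - s1p * s2p * s3p,
    X 6 ^ 2 - X 6 * (s1p * s2p * s3p)}

/-- The inclusion of the subring `ℤ[y₁,y₂,y₃]` into the quotient ring
`ℤ[x₁,x₂,x₃,y₁,y₂,y₃,z]/I`. -/
noncomputable def φy : MvPolynomial (Fin 3) ℤ →+* MvPolynomial (Fin 7) ℤ ⧸ Ig2 :=
  (Ideal.Quotient.mk Ig2).comp
    (eval₂Hom (Int.castRingHom (MvPolynomial (Fin 7) ℤ)) ![X 3, X 4, X 5])

/-- `q` is a combination of the twelve monomials. -/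
def TwelveSpan {R A : Type*} [CommRing R] [CommRing A] (f : R →+* A) (x w z q : A) : Prop :=
  ∃ c : Fin 3 → Fin 2 → Fin 2 → R,
    q = ∑ i₁ : Fin 3, ∑ i₂ : Fin 2, ∑ j : Fin 2,
      f (c i₁ i₂ j) * (x ^ (i₁ : ℕ) * w ^ (i₂ : ℕ) * z ^ (j : ℕ))

section
variable {R A : Type*} [CommRing R] [CommRing A] (f : R →+* A) (x w z : A)

theorem TwelveSpan.add {p q : A} (hp : TwelveSpan f x w z p) (hq : TwelveSpan f x w z q) :
    TwelveSpan f x w z (p + q) := by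
  obtain ⟨c, rfl⟩ := hp
  obtain ⟨d, rfl⟩ := hq
  refine ⟨fun i k j => c i k j + d i k j, ?_⟩
  simp only [map_add, add_mul, Finset.sum_add_distrib]

theorem TwelveSpan.smul (r : R) {p : A} (hp : TwelveSpan f x w z p) :
    TwelveSpan f x w z (f r * p) := by
  obtain ⟨c, rfl⟩ := hp
  refine ⟨fun i k j => r * c i k j, ?_⟩
  simp only [map_mul, Finset.mul_sum, mul_assoc]

theorem TwelveSpan.one : TwelveSpan f x w z 1 := by
  refine ⟨![![![1, 0], ![0, 0]], ![![0, 0], ![0, 0]], ![![0, 0], ![0, 0]]], ?_⟩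
  simp [Fin.sum_univ_succ]

variable (e2 e3 : R)

theorem TwelveSpan.mul_z (hz : z ^ 2 = f e3 * z) {p : A} (hp : TwelveSpan f x w z p) :
    TwelveSpan f x w z (p * z) := by
  obtain ⟨c, rfl⟩ := hp
  refine ⟨fun i k => ![0, c i k 0 + e3 * c i k 1], ?_⟩
  have f2 : f 2 = 2 := map_ofNat f 2
  simp [Fin.sum_univ_three, Fin.sum_univ_two, f2]
  linear_combination (f (c 0 0 1) + f (c 1 0 1) * x + f (c 2 0 1) * x ^ 2
    + (f (c 0 1 1) + f (c 1 1 1) * x + f (c 2 1 1) * x ^ 2) * w) * hz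

theorem TwelveSpan.mul_x (hx : x ^ 3 = - f e2 * x + 2 * z - f e3) (hz : z ^ 2 = f e3 * z)
    {p : A} (hp : TwelveSpan f x w z p) :
    TwelveSpan f x w z (p * x) := by
  obtain ⟨c, rfl⟩ := hp
  refine ⟨![fun k => ![- e3 * c 2 k 0, 2 * c 2 k 0 + e3 * c 2 k 1],
    fun k j => c 0 k j - e2 * c 2 k j, fun k j => c 1 k j], ?_⟩
  have f2 : f 2 = 2 := map_ofNat f 2
  simp [Fin.sum_univ_three, Fin.sum_univ_two, f2]
  linear_combination (f (c 2 0 0) + f (c 2 0 1) * z + f (c 2 1 0) * w + f (c 2 1 1) * w * z) * hx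
    + 2 * (f (c 2 0 1) + f (c 2 1 1) * w) * hz

theorem TwelveSpan.mul_w (hx : x ^ 3 = - f e2 * x + 2 * z - f e3) (hz : z ^ 2 = f e3 * z)
    (hw : w ^ 2 = - x ^ 2 - x * w - f e2)
    {p : A} (hp : TwelveSpan f x w z p) :
    TwelveSpan f x w z (p * w) := by
  obtain ⟨c, rfl⟩ := hp
  refine ⟨![
    ![![- e2 * c 0 1 0 + e3 * c 1 1 0, - e2 * c 0 1 1 - 2 * c 1 1 0 - e3 * c 1 1 1],
      ![c 0 0 0 + e3 * c 2 1 0, c 0 0 1 - 2 * c 2 1 0 - e3 * c 2 1 1]],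
    ![![e3 * c 2 1 0, - 2 * c 2 1 0 - e3 * c 2 1 1],
      fun j => c 1 0 j - c 0 1 j + e2 * c 2 1 j],
    ![fun j => - c 0 1 j, fun j => c 2 0 j - c 1 1 j]], ?_⟩
  have f2 : f 2 = 2 := map_ofNat f 2
  simp [Fin.sum_univ_three, Fin.sum_univ_two, f2]
  linear_combination (f (c 0 1 0) + f (c 0 1 1) * z + (f (c 1 1 0) + f (c 1 1 1) * z) * x
      + (f (c 2 1 0) + f (c 2 1 1) * z) * x ^ 2) * hw
    - (f (c 1 1 0) + f (c 1 1 1) * z + (f (c 2 1 0) + f (c 2 1 1) * z) * (x + w)) * hx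
    - 2 * (f (c 1 1 1) + f (c 2 1 1) * (x + w)) * hz
end

/-- `ℤ[x₁,x₂,x₃,y₁,y₂,y₃,z]/I` is generated, as a module over the subring
`ℤ[y₁,y₂,y₃]`, by the images of the twelve monomials `x₁^{i₁} x₂^{i₂} z^{j}`
with `0 ≤ i₁ ≤ 2`, `0 ≤ i₂ ≤ 1`, `0 ≤ j ≤ 1`. -/
theorem quotient_spanned_by_monomials (q : MvPolynomial (Fin 7) ℤ ⧸ Ig2) :
    ∃ c : Fin 3 → Fin 2 → Fin 2 → MvPolynomial (Fin 3) ℤ,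
      q = ∑ i₁ : Fin 3, ∑ i₂ : Fin 2, ∑ j : Fin 2,
        φy (c i₁ i₂ j) *
          Ideal.Quotient.mk Ig2 (X 0 ^ (i₁ : ℕ) * X 1 ^ (i₂ : ℕ) * X 6 ^ (j : ℕ)) := by
  let m := Ideal.Quotient.mk Ig2
  let e2 : MvPolynomial (Fin 3) ℤ :=
    (X 0 - X 1) * (X 1 - X 2) + (X 0 - X 1) * (X 2 - X 0) + (X 1 - X 2) * (X 2 - X 0)
  let e3 : MvPolynomial (Fin 3) ℤ := (X 0 - X 1) * (X 1 - X 2) * (X 2 - X 0)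
  have y0 : φy (X 0) = m (X 3) := by simp [φy, m]
  have y1 : φy (X 1) = m (X 4) := by simp [φy, m]
  have y2 : φy (X 2) = m (X 5) := by simp [φy, m]
  have r1 : m (X 0 + X 1 + X 2) = 0 :=
    Ideal.Quotient.eq_zero_iff_mem.2 (Ideal.subset_span (by simp))
  have r2 : m ((X 0 * X 1 + X 0 * X 2 + X 1 * X 2)
      - (s1p * s2p + s1p * s3p + s2p * s3p)) = 0 :=
    Ideal.Quotient.eq_zero_iff_mem.2 (Ideal.subset_span (by simp))
  have r3 : m (2 * X 6 - X 0 * X 1 * X 2 - s1p * s2p * s3p) = 0 :=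
    Ideal.Quotient.eq_zero_iff_mem.2 (Ideal.subset_span (by simp))
  have r4 : m (X 6 ^ 2 - X 6 * (s1p * s2p * s3p)) = 0 :=
    Ideal.Quotient.eq_zero_iff_mem.2 (Ideal.subset_span (by simp))
  have he2 : φy e2 = m (s1p * s2p + s1p * s3p + s2p * s3p) := by
    simp only [e2, s1p, s2p, s3p, map_add, map_sub, map_mul, y0, y1, y2]
  have he3 : φy e3 = m (s1p * s2p * s3p) := by
    simp only [e3, s1p, s2p, s3p, map_sub, map_mul, y0, y1, y2]
  rw [map_sub, ← he2] at r2
  rw [map_sub, ← he3] at r3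
  rw [map_sub, map_mul, ← he3] at r4
  simp only [map_add, map_sub, map_mul, map_pow, map_ofNat] at r1 r2 r3 r4
  have hz : m (X 6) ^ 2 = φy e3 * m (X 6) := by linear_combination r4
  have hx : m (X 0) ^ 3 = - φy e2 * m (X 0) + 2 * m (X 6) - φy e3 := by
    linear_combination m (X 0) ^ 2 * r1 - m (X 0) * r2 - r3
  have hw : m (X 1) ^ 2 = - m (X 0) ^ 2 - m (X 0) * m (X 1) - φy e2 := by
    linear_combination (m (X 0) + m (X 1)) * r1 - r2
  suffices h : TwelveSpan φy (m (X 0)) (m (X 1)) (m (X 6)) q by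
    obtain ⟨c, hc⟩ := h
    exact ⟨c, by simpa only [map_mul, map_pow] using hc⟩
  obtain ⟨p, rfl⟩ := Ideal.Quotient.mk_surjective q
  change TwelveSpan φy (m (X 0)) (m (X 1)) (m (X 6)) (m p)
  induction p using MvPolynomial.induction_on with
  | C a =>
    have h := TwelveSpan.smul φy (m (X 0)) (m (X 1)) (m (X 6)) (C a) (TwelveSpan.one _ _ _ _)
    have h2 : φy (C a) * 1 = m (C a) := by simp [φy, m]
    rwa [h2] at h
  | add p q hp hq =>
    rw [map_add]
    exact TwelveSpan.add _ _ _ _ hp hq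
  | mul_X p i hp =>
    have k0 := TwelveSpan.mul_x φy _ _ _ e2 e3 hx hz hp
    have k1 := TwelveSpan.mul_w φy _ _ _ e2 e3 hx hz hw hp
    rw [map_mul]
    fin_cases i
    · exact k0
    · exact k1
    · have h := TwelveSpan.smul _ _ _ _ (-1) (TwelveSpan.add _ _ _ _ k0 k1)
      have h2 : φy (-1) * (m p * m (X 0) + m p * m (X 1)) = m p * m (X 2) := by
        rw [map_neg, map_one]
        linear_combination - m p * r1
      rw [h2] at h
      exact h
    · have h := TwelveSpan.smul _ _ _ _ (X 0) hp
      rw [y0, mul_comm] at h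
      exact h
    · have h := TwelveSpan.smul _ _ _ _ (X 1) hp
      rw [y1, mul_comm] at h
      exact h
    · have h := TwelveSpan.smul _ _ _ _ (X 2) hp
      rw [y2, mul_comm] at h
      exact h
    · exact TwelveSpan.mul_z φy _ _ _ e3 hz hp
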